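/- Fix a bijection ⟨·,·⟩ : ℕ × ℕ → ℕ. Let g : [ℕ]^3 → ℕ be a 2-bounded coloring such that ℕ is a 1-tail g-rainbow, and define g̃(x₀,x₁,x₂) = min{⟨y₀,y₁⟩ : y₀ < y₁ < x₂ and g(y₀,y₁,x₂) = g(x₀,x₁,x₂)} and ḡ(x₀,x₁,x₂) = ⟨g̃(x₀,x₁,x₂), x₂⟩. Then ḡ is a 2-bounded semi-normal coloring, and a set X ⊆ ℕ is a tail ḡ-rainbow if and only if X is a tail g-rainbow. -/

import Mathlib

namespace RRT

/-- A coloring of `[ℕ]³` (identified with strictly increasing triples) is 2-bounded if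
every color has at most 2 preimages. -/
def Bounded2Triples (f : ℕ → ℕ → ℕ → ℕ) : Prop :=
  ∀ c : ℕ, {t : ℕ × ℕ × ℕ | t.1 < t.2.1 ∧ t.2.1 < t.2.2 ∧ f t.1 t.2.1 t.2.2 = c}.encard ≤ 2

/-- `X` is an `f`-rainbow for a coloring of triples: `f` is injective on `[X]³`. -/
def Rainbow3On (f : ℕ → ℕ → ℕ → ℕ) (X : Set ℕ) : Prop :=
  ∀ x₀ x₁ x₂ y₀ y₁ y₂ : ℕ, x₀ ∈ X → x₁ ∈ X → x₂ ∈ X → y₀ ∈ X → y₁ ∈ X → y₂ ∈ X →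
    x₀ < x₁ → x₁ < x₂ → y₀ < y₁ → y₁ < y₂ →
    f x₀ x₁ x₂ = f y₀ y₁ y₂ → x₀ = y₀ ∧ x₁ = y₁ ∧ x₂ = y₂


/-- `X` is a 1-tail `g`-rainbow: triples from `X` with distinct last coordinates get
distinct colors. -/
def OneTailRainbow3On (g : ℕ → ℕ → ℕ → ℕ) (X : Set ℕ) : Prop :=
  ∀ x₀ x₁ x₂ y₀ y₁ y₂ : ℕ, x₀ ∈ X → x₁ ∈ X → x₂ ∈ X → y₀ ∈ X → y₁ ∈ X → y₂ ∈ X →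
    x₀ < x₁ → x₁ < x₂ → y₀ < y₁ → y₁ < y₂ →
    x₂ ≠ y₂ → g x₀ x₁ x₂ ≠ g y₀ y₁ y₂

/-- `X` is a tail `g`-rainbow: triples from `X` with distinct last-two coordinates get
distinct colors. -/
def TailRainbow3On (g : ℕ → ℕ → ℕ → ℕ) (X : Set ℕ) : Prop :=
  ∀ x₀ x₁ x₂ y₀ y₁ y₂ : ℕ, x₀ ∈ X → x₁ ∈ X → x₂ ∈ X → y₀ ∈ X → y₁ ∈ X → y₂ ∈ X →
    x₀ < x₁ → x₁ < x₂ → y₀ < y₁ → y₁ < y₂ →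
    (x₁, x₂) ≠ (y₁, y₂) → g x₀ x₁ x₂ ≠ g y₀ y₁ y₂

/-- `g̃(x₀,x₁,x₂) = min {⟨y₀,y₁⟩ : y₀ < y₁ < x₂ and g(y₀,y₁,x₂) = g(x₀,x₁,x₂)}`. -/
noncomputable def gtilde3 (pair : ℕ → ℕ → ℕ) (g : ℕ → ℕ → ℕ → ℕ) (x₀ x₁ x₂ : ℕ) : ℕ :=
  sInf {c : ℕ | ∃ y₀ y₁ : ℕ, y₀ < y₁ ∧ y₁ < x₂ ∧ g y₀ y₁ x₂ = g x₀ x₁ x₂ ∧ c = pair y₀ y₁}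

/-- A 2-bounded coloring `g` of `[ℕ]³` is semi-normal (w.r.t. the fixed pairing) if
`g(x₀,x₁,x₂) = ⟨g̃(x₀,x₁,x₂), x₂⟩` for all `x₀ < x₁ < x₂`. -/
def SemiNormal (pair : ℕ → ℕ → ℕ) (g : ℕ → ℕ → ℕ → ℕ) : Prop :=
  ∀ x₀ x₁ x₂ : ℕ, x₀ < x₁ → x₁ < x₂ →
    g x₀ x₁ x₂ = pair (gtilde3 pair g x₀ x₁ x₂) x₂

/-- for a bijection `⟨·,·⟩ : ℕ × ℕ → ℕ` and a 2-bounded coloring `g` of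
`[ℕ]³` with ℕ a 1-tail `g`-rainbow, the coloring `ḡ(x₀,x₁,x₂) = ⟨g̃(x₀,x₁,x₂), x₂⟩` is a
2-bounded semi-normal coloring, and a set `X` is a tail `ḡ`-rainbow iff it is a tail
`g`-rainbow. -/
theorem statement15 (pair : ℕ → ℕ → ℕ)
    (hbij : Function.Bijective fun p : ℕ × ℕ => pair p.1 p.2)
    (g : ℕ → ℕ → ℕ → ℕ) (hbounded : Bounded2Triples g)
    (h1tail : OneTailRainbow3On g Set.univ) :
    (Bounded2Triples fun x₀ x₁ x₂ => pair (gtilde3 pair g x₀ x₁ x₂) x₂) ∧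
    (SemiNormal pair fun x₀ x₁ x₂ => pair (gtilde3 pair g x₀ x₁ x₂) x₂) ∧
    (∀ X : Set ℕ,
      TailRainbow3On (fun x₀ x₁ x₂ => pair (gtilde3 pair g x₀ x₁ x₂) x₂) X ↔
        TailRainbow3On g X) := by
  have hinj : ∀ a b c d : ℕ, pair a b = pair c d → a = c ∧ b = d := by
    intro a b c d h
    have := @hbij.1 (a, b) (c, d) h
    simpa using this
  have hmem : ∀ x₀ x₁ x₂ : ℕ, x₀ < x₁ → x₁ < x₂ → ∃ y₀ y₁ : ℕ, y₀ < y₁ ∧ y₁ < x₂ ∧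
      g y₀ y₁ x₂ = g x₀ x₁ x₂ ∧ gtilde3 pair g x₀ x₁ x₂ = pair y₀ y₁ := by
    intro x₀ x₁ x₂ h0 h1
    exact Nat.sInf_mem (s := {c : ℕ | ∃ y₀ y₁ : ℕ, y₀ < y₁ ∧ y₁ < x₂ ∧
      g y₀ y₁ x₂ = g x₀ x₁ x₂ ∧ c = pair y₀ y₁}) ⟨pair x₀ x₁, x₀, x₁, h0, h1, rfl, rfl⟩
  have key : ∀ x₀ x₁ x₂ y₀ y₁ y₂ : ℕ, x₀ < x₁ → x₁ < x₂ → y₀ < y₁ → y₁ < y₂ →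
      (pair (gtilde3 pair g x₀ x₁ x₂) x₂ = pair (gtilde3 pair g y₀ y₁ y₂) y₂ ↔
        g x₀ x₁ x₂ = g y₀ y₁ y₂) := by
    intro x₀ x₁ x₂ y₀ y₁ y₂ hx0 hx1 hy0 hy1
    constructor
    · intro h
      obtain ⟨h, rfl⟩ := hinj _ _ _ _ h
      obtain ⟨a, b, -, -, hab, e1⟩ := hmem x₀ x₁ x₂ hx0 hx1
      obtain ⟨c, d, -, -, hcd, e2⟩ := hmem y₀ y₁ x₂ hy0 hy1
      obtain ⟨rfl, rfl⟩ := hinj a b c d (by rw [← e1, ← e2, h])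
      rw [← hab, hcd]
    · intro h
      have h2 : x₂ = y₂ := by
        by_contra hne
        exact h1tail x₀ x₁ x₂ y₀ y₁ y₂ trivial trivial trivial trivial trivial trivial
          hx0 hx1 hy0 hy1 hne h
      subst h2
      unfold gtilde3
      rw [h]
  refine ⟨?_, ?_, ?_⟩
  · intro c
    rcases Set.eq_empty_or_nonempty {t : ℕ × ℕ × ℕ | t.1 < t.2.1 ∧ t.2.1 < t.2.2 ∧
      pair (gtilde3 pair g t.1 t.2.1 t.2.2) t.2.2 = c} with he | ⟨t, ht0, ht1, htc⟩
    · simp only [he, Set.encard_empty]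
      exact zero_le
    · refine le_trans (Set.encard_le_encard ?_) (hbounded (g t.1 t.2.1 t.2.2))
      rintro s ⟨hs0, hs1, hsc⟩
      exact ⟨hs0, hs1, (key _ _ _ _ _ _ hs0 hs1 ht0 ht1).1 (hsc.trans htc.symm)⟩
  · intro x₀ x₁ x₂ h0 h1
    show pair (gtilde3 pair g x₀ x₁ x₂) x₂ = _
    congr 1
    unfold gtilde3
    congr 1
    ext c
    constructor
    · rintro ⟨a, b, hab, hb, e, rfl⟩
      exact ⟨a, b, hab, hb, (key _ _ _ _ _ _ hab hb h0 h1).2 e, rfl⟩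
    · rintro ⟨a, b, hab, hb, e, rfl⟩
      exact ⟨a, b, hab, hb, (key _ _ _ _ _ _ hab hb h0 h1).1 e, rfl⟩
  · intro X
    constructor
    · intro H x₀ x₁ x₂ y₀ y₁ y₂ a b c d e f h0 h1 h2 h3 hne h
      exact H x₀ x₁ x₂ y₀ y₁ y₂ a b c d e f h0 h1 h2 h3 hne
        ((key _ _ _ _ _ _ h0 h1 h2 h3).2 h)
    · intro H x₀ x₁ x₂ y₀ y₁ y₂ a b c d e f h0 h1 h2 h3 hne h
      exact H x₀ x₁ x₂ y₀ y₁ y₂ a b c d e f h0 h1 h2 h3 hne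
        ((key _ _ _ _ _ _ h0 h1 h2 h3).1 h)

end RRT
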